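/- arXiv:1704.08022 — 2 statements merged into one kernel-verified Lean document; each statement's English description precedes it below -/
import Mathlib

section
/- Let Ω, Ω′ ⊂ ℝⁿ be bounded domains. If an almost everywhere injective mapping φ : Ω → Ω′ with φ ∈ W¹_1(Ω) and J(x,φ) ≥ 0 a.e. in Ω has the Luzin 𝒩^{−1}-property, then J(x,φ) > 0 for almost all x ∈ Ω. -/
open MeasureTheory Set Filter Topology Metric Matrix
open scoped ENNReal NNReal

noncomputable section

/-- Euclidean space `ℝⁿ`. -/
abbrev Ev (n : ℕ) := EuclideanSpace ℝ (Fin n)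

/-- `n × n` real matrices. -/
abbrev Mat (n : ℕ) := Matrix (Fin n) (Fin n) ℝ

namespace Paper

variable {n : ℕ}

/-- Frobenius norm of a matrix. -/
def matNorm {n : ℕ} (A : Mat n) : ℝ := Real.sqrt (∑ i, ∑ j, (A i j) ^ 2)

/-- A bounded domain: a nonempty connected open bounded set. -/
def IsBoundedDomain {n : ℕ} (Ω : Set (Ev n)) : Prop :=
  IsOpen Ω ∧ IsConnected Ω ∧ Bornology.IsBounded Ω

/-- `Ω` has Lipschitz boundary: near each boundary point, in some Cartesian coordinate
system (an affine isometry of `ℝⁿ`), `Ω` is the subgraph of a Lipschitz function of the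
remaining `n − 1` coordinates. -/
def HasLipschitzBoundary {n : ℕ} (Ω : Set (Ev n)) : Prop :=
  ∀ x ∈ frontier Ω, ∃ U : Set (Ev n), IsOpen U ∧ x ∈ U ∧
    ∃ (e : Ev n ≃ᵃⁱ[ℝ] Ev n) (i : Fin n) (f : Ev n → ℝ) (L : ℝ≥0),
      LipschitzWith L f ∧
      (∀ y z : Ev n, (∀ j : Fin n, j ≠ i → y j = z j) → f y = f z) ∧
      Ω ∩ U = {y ∈ U | e y i < f (e y)}

/-- `Df` is the weak (distributional) derivative of `f : Ω → ℝⁿ` on the open set `Ω`. -/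
def IsWeakDeriv {n : ℕ} (Ω : Set (Ev n)) (f : Ev n → Ev n) (Df : Ev n → Mat n) : Prop :=
  (∀ i j : Fin n, LocallyIntegrableOn (fun x => Df x i j) Ω) ∧
  ∀ η : Ev n → ℝ, ContDiff ℝ (⊤ : ℕ∞) η → HasCompactSupport η → tsupport η ⊆ Ω →
    ∀ i j : Fin n,
      ∫ x in Ω, f x i * fderiv ℝ η x (EuclideanSpace.single j 1)
        = - ∫ x in Ω, Df x i j * η x

/-- `Du` is the weak gradient of the scalar function `u` on the open set `Ω`. -/
def IsWeakGrad {n : ℕ} (Ω : Set (Ev n)) (u : Ev n → ℝ) (Du : Ev n → Ev n) : Prop :=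
  (∀ j : Fin n, LocallyIntegrableOn (fun x => Du x j) Ω) ∧
  ∀ η : Ev n → ℝ, ContDiff ℝ (⊤ : ℕ∞) η → HasCompactSupport η → tsupport η ⊆ Ω →
    ∀ j : Fin n,
      ∫ x in Ω, u x * fderiv ℝ η x (EuclideanSpace.single j 1)
        = - ∫ x in Ω, Du x j * η x

/-- Membership in the local Sobolev class `W¹_{p,loc}(Ω)` (for mappings `Ω → ℝⁿ`),
with given weak derivative `Df`. -/
def MemW1loc {n : ℕ} (p : ℝ) (Ω : Set (Ev n)) (f : Ev n → Ev n) (Df : Ev n → Mat n) : Prop :=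
  LocallyIntegrableOn f Ω ∧ IsWeakDeriv Ω f Df ∧
  ∀ K : Set (Ev n), IsCompact K → K ⊆ Ω →
    ∫⁻ x in K, ENNReal.ofReal (matNorm (Df x) ^ p) < ⊤

/-- Membership in the Sobolev class `W¹_p(Ω)` (global integrability over `Ω`),
with given weak derivative `Df`. -/
def MemW1 {n : ℕ} (p : ℝ) (Ω : Set (Ev n)) (f : Ev n → Ev n) (Df : Ev n → Mat n) : Prop :=
  IntegrableOn f Ω volume ∧ IsWeakDeriv Ω f Df ∧
  ∫⁻ x in Ω, ENNReal.ofReal (matNorm (Df x) ^ p) < ⊤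

/-- `φ` is a homeomorphism of `Ω` onto `Ω'` with (two-sided) inverse `ψ`. -/
structure IsHomeoOn {n : ℕ} (φ ψ : Ev n → Ev n) (Ω Ω' : Set (Ev n)) : Prop where
  cont : ContinuousOn φ Ω
  cont_inv : ContinuousOn ψ Ω'
  mapsTo : MapsTo φ Ω Ω'
  mapsTo_inv : MapsTo ψ Ω' Ω
  left_inv : ∀ x ∈ Ω, ψ (φ x) = x
  right_inv : ∀ y ∈ Ω', φ (ψ y) = y

/-- `φ` is a homeomorphism of `Ω` onto `Ω'`. -/
def IsHomeo {n : ℕ} (φ : Ev n → Ev n) (Ω Ω' : Set (Ev n)) : Prop :=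
  ∃ ψ : Ev n → Ev n, IsHomeoOn φ ψ Ω Ω'

/-- A mapping (given through its weak derivative `Df`) has finite distortion on `Ω`:
`|Df(x)|ⁿ ≤ K(x)·|J(x,f)|` a.e. with `1 ≤ K(x) < ∞` a.e. -/
def HasFiniteDistortionOn (n : ℕ) (Ω : Set (Ev n)) (Df : Ev n → Mat n) : Prop :=
  ∃ K : Ev n → ℝ, (∀ᵐ x ∂(volume.restrict Ω), 1 ≤ K x) ∧
    ∀ᵐ x ∂(volume.restrict Ω), matNorm (Df x) ^ n ≤ K x * |(Df x).det|

/-- Finite codistortion: `Adj Df(x) = 0` a.e. on the zero set of the Jacobian. -/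
def HasFiniteCodistortionOn (n : ℕ) (Ω : Set (Ev n)) (Df : Ev n → Mat n) : Prop :=
  ∀ᵐ x ∂(volume.restrict Ω), (Df x).det = 0 → (Df x).adjugate = 0

/-- Outer distortion coefficient `K_O(x,f) = |Df(x)|ⁿ / J(x,f)` (`= 1` off `{0 < J < ∞}`). -/
def KO (n : ℕ) (Df : Ev n → Mat n) (x : Ev n) : ℝ :=
  if 0 < (Df x).det then matNorm (Df x) ^ n / (Df x).det else 1

/-- Inner distortion coefficient `K_I(x,f) = |Adj Df(x)|ⁿ / J(x,f)^{n−1}`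
(`= 1` off `{0 < J < ∞}`). -/
def KI (n : ℕ) (Df : Ev n → Mat n) (x : Ev n) : ℝ :=
  if 0 < (Df x).det then matNorm ((Df x).adjugate) ^ n / (Df x).det ^ (n - 1) else 1

/-- Outer distortion operator function `K_{f,p}(x) = |Df(x)| / |J(x,f)|^{1/p}`,
equal to `0` on the zero set of the Jacobian. -/
def KopOuter (p : ℝ≥0∞) (Df : Ev n → Mat n) (x : Ev n) : ℝ :=
  if (Df x).det = 0 then 0
  else matNorm (Df x) / |(Df x).det| ^ (1 / p.toReal)

/-- Inner distortion operator function `𝒦_{f,p}(x) = |Adj Df(x)| / |J(x,f)|^{(n−1)/p}`,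
equal to `0` on the zero set of the Jacobian. -/
def KopInner (n : ℕ) (p : ℝ≥0∞) (Df : Ev n → Mat n) (x : Ev n) : ℝ :=
  if (Df x).det = 0 then 0
  else matNorm ((Df x).adjugate) / |(Df x).det| ^ (((n : ℝ) - 1) / p.toReal)

/-- The coefficient vector of the pullback `f̃*ω` of an `(n−1)`-form (identified with its
coefficient vector `a`), extended by `0` on the zero set of the Jacobian:
`(f̃*ω)(x) = Adj Dφ(x) ⬝ a(φ(x))`. -/
def pullbackCoeff {n : ℕ} (φ : Ev n → Ev n) (Dφ : Ev n → Mat n) (a : Ev n → Ev n)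
    (x : Ev n) : Ev n :=
  if (Dφ x).det = 0 then 0
  else (WithLp.equiv 2 (∀ _ : Fin n, ℝ)).symm ((Dφ x).adjugate.mulVec (fun j => a (φ x) j))

/-- `φ` induces a pullback operator
`φ̃* : 𝓛_p(Ω', Λ^{n−1}) → 𝓛_q(Ω, Λ^{n−1})` of norm at most `C`. -/
def PullbackBounded {n : ℕ} (Ω Ω' : Set (Ev n)) (φ : Ev n → Ev n) (Dφ : Ev n → Mat n)
    (p q : ℝ≥0∞) (C : ℝ≥0∞) : Prop :=
  ∀ a : Ev n → Ev n, Measurable a →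
    eLpNorm (pullbackCoeff φ Dφ a) q (volume.restrict Ω)
      ≤ C * eLpNorm a p (volume.restrict Ω')

/-- The operator norm of the pullback operator `φ̃*` from `𝓛_p(Ω')` to `𝓛_q(Ω)`. -/
def pullbackOpNorm {n : ℕ} (Ω Ω' : Set (Ev n)) (φ : Ev n → Ev n) (Dφ : Ev n → Mat n)
    (p q : ℝ≥0∞) : ℝ≥0∞ :=
  sInf {C : ℝ≥0∞ | PullbackBounded Ω Ω' φ Dφ p q C}

/-- `φ : Ω → Ω'` induces a bounded composition operator
`φ* : L¹_p(Ω') ∩ Lip_loc(Ω') → L¹_q(Ω)`, `φ*(u) = u ∘ φ`, with norm at most `C`. -/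
def CompOpBounded {n : ℕ} (Ω Ω' : Set (Ev n)) (φ : Ev n → Ev n)
    (p q : ℝ≥0∞) (C : ℝ≥0∞) : Prop :=
  ∀ (u : Ev n → ℝ) (Du : Ev n → Ev n),
    (∀ K : Set (Ev n), IsCompact K → K ⊆ Ω' → ∃ L : ℝ≥0, LipschitzOnWith L u K) →
    IsWeakGrad Ω' u Du →
    eLpNorm Du p (volume.restrict Ω') < ⊤ →
    ∃ Dv : Ev n → Ev n, IsWeakGrad Ω (u ∘ φ) Dv ∧
      eLpNorm Dv q (volume.restrict Ω) ≤ C * eLpNorm Du p (volume.restrict Ω')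

/-- The operator norm of the composition operator `φ* : L¹_p(Ω') → L¹_q(Ω)`. -/
def compOpNorm {n : ℕ} (Ω Ω' : Set (Ev n)) (φ : Ev n → Ev n) (p q : ℝ≥0∞) : ℝ≥0∞ :=
  sInf {C : ℝ≥0∞ | CompOpBounded Ω Ω' φ p q C}

/-- `φ : Ω → Ω'` induces a bounded composition operator
`φ* : L¹_p(Ω') ∩ Lip(Ω') → L¹_q(Ω)` with norm at most `C` (globally Lipschitz test
functions). -/
def CompOpBoundedLip {n : ℕ} (Ω Ω' : Set (Ev n)) (φ : Ev n → Ev n)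
    (p q : ℝ≥0∞) (C : ℝ≥0∞) : Prop :=
  ∀ (u : Ev n → ℝ) (Du : Ev n → Ev n) (L : ℝ≥0),
    LipschitzOnWith L u Ω' →
    IsWeakGrad Ω' u Du →
    eLpNorm Du p (volume.restrict Ω') < ⊤ →
    ∃ Dv : Ev n → Ev n, IsWeakGrad Ω (u ∘ φ) Dv ∧
      eLpNorm Dv q (volume.restrict Ω) ≤ C * eLpNorm Du p (volume.restrict Ω')

/-- Weak convergence `f_k ⇀ f₀` in `W¹_{p,loc}(Ω)`: all the mappings belong to
`W¹_{p,loc}(Ω)`, the `W¹_p`-norms are bounded on compact subsets, and functions and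
weak derivatives converge as distributions. -/
def WeakConvW1loc {n : ℕ} (p : ℝ) (Ω : Set (Ev n))
    (f : ℕ → Ev n → Ev n) (Df : ℕ → Ev n → Mat n)
    (f0 : Ev n → Ev n) (Df0 : Ev n → Mat n) : Prop :=
  (∀ k, MemW1loc p Ω (f k) (Df k)) ∧ MemW1loc p Ω f0 Df0 ∧
  (∀ K : Set (Ev n), IsCompact K → K ⊆ Ω → ∃ C : ℝ,
    ∀ k, (∫⁻ x in K, ENNReal.ofReal (matNorm (Df k x) ^ p)) ≤ ENNReal.ofReal C) ∧
  ∀ θ : Ev n → ℝ, ContDiff ℝ (⊤ : ℕ∞) θ → HasCompactSupport θ → tsupport θ ⊆ Ω →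
    (∀ i : Fin n,
      Tendsto (fun k => ∫ x in Ω, θ x * f k x i) atTop (𝓝 (∫ x in Ω, θ x * f0 x i))) ∧
    (∀ i j : Fin n,
      Tendsto (fun k => ∫ x in Ω, θ x * Df k x i j) atTop (𝓝 (∫ x in Ω, θ x * Df0 x i j)))

/-- `φ` is injective almost everywhere on `Ω`: injective outside some negligible set. -/
def AEInjectiveOn {n : ℕ} (φ : Ev n → Ev n) (Ω : Set (Ev n)) : Prop :=
  ∃ S : Set (Ev n), S ⊆ Ω ∧ volume S = 0 ∧ Set.InjOn φ (Ω \ S)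

end Paper

namespace Paper

/-- The rescaled kernel `w ↦ t⁻ⁿ κ((w - x) / t)`. -/
def scaledKernel (κ : Ev n → ℝ) (x : Ev n) (t : ℝ) (w : Ev n) : ℝ :=
  t⁻¹ ^ n * κ (t⁻¹ • (w - x))

lemma continuous_scaledKernel {κ : Ev n → ℝ} (hκ : Continuous κ) (x : Ev n) (t : ℝ) :
    Continuous (scaledKernel κ x t) := by
  unfold scaledKernel; fun_prop

lemma scaledKernel_eq_zero {κ : Ev n → ℝ} {R : ℝ} (hs : tsupport κ ⊆ closedBall 0 R)
    {x w : Ev n} {t : ℝ} (ht : 0 < t) (hw : w ∉ closedBall x (R * t)) :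
    scaledKernel κ x t w = 0 := by
  unfold scaledKernel
  rw [image_eq_zero_of_notMem_tsupport (f := κ) (x := t⁻¹ • (w - x)), mul_zero]
  intro h
  have := hs h
  rw [mem_closedBall_zero_iff, norm_smul, norm_inv, Real.norm_of_nonneg ht.le,
    inv_mul_le_iff₀ ht] at this
  exact hw (by rw [mem_closedBall, dist_eq_norm]; linarith)

lemma tsupport_scaledKernel_subset {κ : Ev n → ℝ} {R : ℝ} (hs : tsupport κ ⊆ closedBall 0 R)
    (x : Ev n) {t : ℝ} (ht : 0 < t) :
    tsupport (scaledKernel κ x t) ⊆ closedBall x (R * t) := by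
  refine closure_minimal (fun w hw => ?_) isClosed_closedBall
  by_contra h
  exact hw (scaledKernel_eq_zero hs ht h)

lemma integral_scaledKernel (κ : Ev n → ℝ) (x : Ev n) {t : ℝ} (ht : 0 < t) :
    ∫ w, scaledKernel κ x t w = ∫ z, κ z := by
  unfold scaledKernel
  rw [integral_const_mul, integral_sub_right_eq_self (fun w => κ (t⁻¹ • w)) x,
    Measure.integral_comp_inv_smul_of_nonneg _ _ ht.le, finrank_euclideanSpace_fin, smul_eq_mul,
    ← mul_assoc, ← mul_pow, inv_mul_cancel₀ ht.ne', one_pow, one_mul]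

lemma abs_scaledKernel_le {κ : Ev n → ℝ} {C : ℝ} (hC : ∀ z, |κ z| ≤ C) (x w : Ev n) {t : ℝ}
    (ht : 0 < t) : |scaledKernel κ x t w| ≤ t⁻¹ ^ n * C := by
  unfold scaledKernel
  rw [abs_mul, abs_of_pos (by positivity)]
  gcongr
  exact hC _

lemma setIntegral_closedBall_eq (f : Ev n → ℝ) (x : Ev n) {r : ℝ} (hr : 0 < r) :
    ∫ w in closedBall x r, f w =
      r ^ n * volume.real (closedBall (0 : Ev n) 1) * ⨍ w in closedBall x r, f w := by
  have h : volume.real (closedBall x r) = r ^ n * volume.real (closedBall (0 : Ev n) 1) := by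
    rw [measureReal_def, Measure.addHaar_closedBall' _ _ hr.le, ENNReal.toReal_mul,
      finrank_euclideanSpace_fin, ENNReal.toReal_ofReal (by positivity), measureReal_def]
  have h0 : volume.real (closedBall x r) ≠ 0 :=
    (ENNReal.toReal_pos (measure_closedBall_pos _ _ hr).ne'
      measure_closedBall_lt_top.ne).ne'
  rw [setAverage_eq, ← h, smul_eq_mul, mul_inv_cancel_left₀ h0]

lemma integrableOn_mul_of_bounded {Ω : Set (Ev n)} {h k : Ev n → ℝ} (hh : IntegrableOn h Ω)
    (hk : Continuous k) {C : ℝ} (hC : ∀ z, |k z| ≤ C) :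
    IntegrableOn (fun w => h w * k w) Ω :=
  Integrable.mul_bdd hh hk.aestronglyMeasurable (ae_of_all _ hC)

/-- Pairing with a rescaled kernel approximates the value at a Lebesgue point. -/
lemma abs_integral_mul_scaledKernel_sub_le {Ω : Set (Ev n)} (hΩ : MeasurableSet Ω)
    {h κ : Ev n → ℝ} (hh : IntegrableOn h Ω) (hκ : Continuous κ) {C R : ℝ} (hR : 0 < R)
    (hC : ∀ z, |κ z| ≤ C) (hs : tsupport κ ⊆ closedBall 0 R) {x : Ev n} {t : ℝ} (ht : 0 < t)
    (hB : closedBall x (R * t) ⊆ Ω) :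
    |(∫ w in Ω, h w * scaledKernel κ x t w) - h x * ∫ z, κ z| ≤
      C * R ^ n * volume.real (closedBall (0 : Ev n) 1) *
        ⨍ w in closedBall x (R * t), |h w - h x| := by
  have hC0 : 0 ≤ C := (abs_nonneg _).trans (hC 0)
  have e1 : ∫ w in Ω, h w * scaledKernel κ x t w
      = ∫ w in closedBall x (R * t), h w * scaledKernel κ x t w :=
    setIntegral_eq_of_subset_of_forall_sdiff_eq_zero hΩ hB
      (fun w hw => by rw [scaledKernel_eq_zero hs ht hw.2, mul_zero])
  have e2 : ∫ z, κ z = ∫ w in closedBall x (R * t), scaledKernel κ x t w := by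
    rw [← integral_scaledKernel κ x ht]
    exact (setIntegral_eq_integral_of_forall_compl_eq_zero
      (fun w hw => scaledKernel_eq_zero hs ht hw)).symm
  have hhB : IntegrableOn h (closedBall x (R * t)) := hh.mono_set hB
  have hcB : IntegrableOn (fun _ => h x) (closedBall x (R * t)) :=
    integrableOn_const measure_closedBall_lt_top.ne
  have hKc := continuous_scaledKernel hκ x t
  have hKb := fun w => abs_scaledKernel_le hC x w ht
  rw [e1, e2, ← integral_const_mul, ← integral_sub
    (integrableOn_mul_of_bounded hhB hKc hKb) (integrableOn_mul_of_bounded hcB hKc hKb)]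
  calc _ ≤ ∫ w in closedBall x (R * t), t⁻¹ ^ n * C * |h w - h x| := by
        rw [← Real.norm_eq_abs]
        refine norm_integral_le_of_norm_le ((hhB.sub hcB).abs.const_mul _) (ae_of_all _ fun w => ?_)
        rw [← sub_mul, Real.norm_eq_abs, abs_mul, mul_comm]
        exact mul_le_mul_of_nonneg_right (hKb w) (abs_nonneg _)
    _ = _ := by
        rw [integral_const_mul, setIntegral_closedBall_eq _ _ (by positivity), mul_pow, inv_pow]
        field_simp

/-- The derivative in the scale parameter of a pairing with a rescaled kernel. -/
lemma hasDerivAt_integral_mul_scaledKernel {Ω : Set (Ev n)} {u η : Ev n → ℝ}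
    (hu : IntegrableOn u Ω) (hη : ContDiff ℝ (⊤ : ℕ∞) η) (hc : HasCompactSupport η) (x : Ev n)
    {t : ℝ} (ht : 0 < t) :
    HasDerivAt (fun s => ∫ w in Ω, u w * scaledKernel η x s w)
      (-∫ w in Ω, u w * (t⁻¹ * scaledKernel (fun z => n * η z + fderiv ℝ η z z) x t w)) t := by
  set Θ : Ev n → ℝ := fun z => n * η z + fderiv ℝ η z z with hΘ
  have hηc : Continuous η := hη.continuous
  have hΘc : Continuous Θ := by
    have := hη.continuous_fderiv (by simp)
    fun_prop
  have hΘs : HasCompactSupport Θ := by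
    refine hc.mono' fun z hz => ?_
    by_contra h
    apply hz
    have h2 : z ∉ tsupport (fderiv ℝ η) := fun h' => h (tsupport_fderiv_subset ℝ h')
    simp [hΘ, image_eq_zero_of_notMem_tsupport h, image_eq_zero_of_notMem_tsupport h2]
  obtain ⟨C, hC⟩ := hηc.bounded_above_of_compact_support hc
  obtain ⟨D, hD⟩ := hΘc.bounded_above_of_compact_support hΘs
  have hD0 : 0 ≤ D := (norm_nonneg _).trans (hD 0)
  rw [← integral_neg]
  have hpos : ∀ s ∈ Ioi (t / 2), 0 < s := fun s hs => (half_pos ht).trans hs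
  refine (hasDerivAt_integral_of_dominated_loc_of_deriv_le (s := Ioi (t / 2))
    (F' := fun s w => -(u w * (s⁻¹ * scaledKernel Θ x s w)))
    (bound := fun w => |u w| * ((t / 2)⁻¹ * ((t / 2)⁻¹ ^ n * D)))
    (Ioi_mem_nhds (half_lt_self ht)) ?_ ?_ ?_ ?_ ?_ ?_).2
  · exact Eventually.of_forall fun s => hu.aestronglyMeasurable.mul
      (continuous_scaledKernel hηc x s).aestronglyMeasurable
  · exact integrableOn_mul_of_bounded hu (continuous_scaledKernel hηc x t)
      (fun w => abs_scaledKernel_le hC x w ht)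
  · exact (hu.aestronglyMeasurable.mul
      (continuous_const.mul (continuous_scaledKernel hΘc x t)).aestronglyMeasurable).neg
  · refine ae_of_all _ fun w s hs => ?_
    have hs0 := hpos s hs
    have hst : s⁻¹ ≤ (t / 2)⁻¹ := inv_anti₀ (half_pos ht) (le_of_lt hs)
    rw [norm_neg, norm_mul, norm_mul, Real.norm_eq_abs, norm_inv, Real.norm_of_nonneg hs0.le]
    have h1 : ‖scaledKernel Θ x s w‖ ≤ (t / 2)⁻¹ ^ n * D :=
      (abs_scaledKernel_le hD x w hs0).trans (by gcongr)
    gcongr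
  · exact hu.abs.mul_const _
  · refine ae_of_all _ fun w s hs => ?_
    have hs0 := (hpos s hs).ne'
    have hi : HasDerivAt (fun s : ℝ => s⁻¹) (-(s ^ 2)⁻¹) s := hasDerivAt_inv hs0
    have h1 := ((hη.differentiable (by simp)) (s⁻¹ • (w - x))).hasFDerivAt.comp_hasDerivAt s
      (hi.smul_const (w - x))
    have h2 := ((hi.pow n).mul h1).const_mul (u w)
    refine h2.congr_deriv ?_
    simp only [scaledKernel, hΘ, map_smul, smul_eq_mul]
    rcases n with _ | m
    · simp; left; field_simp
    · simp only [Nat.add_sub_cancel, Pi.pow_apply, Function.comp_apply]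
      generalize η (s⁻¹ • (w - x)) = a
      generalize fderiv ℝ η (s⁻¹ • (w - x)) (w - x) = b
      push_cast
      rw [← inv_pow]
      ring

/-- The weak-gradient identity applied to the radial fields generating the dilation. -/
lemma integral_mul_scaledKernel_radial {Ω : Set (Ev n)} {u η : Ev n → ℝ} {G : Ev n → Fin n → ℝ}
    (hu : IntegrableOn u Ω)
    (hG : ∀ η : Ev n → ℝ, ContDiff ℝ (⊤ : ℕ∞) η → HasCompactSupport η → tsupport η ⊆ Ω →
      ∀ j : Fin n, ∫ x in Ω, u x * fderiv ℝ η x (EuclideanSpace.single j 1)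
        = - ∫ x in Ω, G x j * η x)
    (hη : ContDiff ℝ (⊤ : ℕ∞) η) {R : ℝ} (hs : tsupport η ⊆ closedBall 0 R) {x : Ev n}
    {t : ℝ} (ht : 0 < t) (hB : closedBall x (R * t) ⊆ Ω) :
    ∫ w in Ω, u w * (t⁻¹ * scaledKernel (fun z => n * η z + fderiv ℝ η z z) x t w) =
      -∑ j, ∫ w in Ω, G w j * scaledKernel (fun z => η z * z j) x t w := by
  have hsj : ∀ j : Fin n, tsupport (fun z : Ev n => η z * z j) ⊆ closedBall 0 R := fun j =>
    (tsupport_mul_subset_left).trans hs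
  have hdj : ∀ j : Fin n, ContDiff ℝ (⊤ : ℕ∞) (fun z : Ev n => η z * z j) := fun j => by
    fun_prop
  have hdK : ∀ j : Fin n, ContDiff ℝ (⊤ : ℕ∞) (scaledKernel (fun z : Ev n => η z * z j) x t) :=
    fun j => by
      have := hdj j
      unfold scaledKernel
      exact contDiff_const.mul (this.comp (g := fun z : Ev n => η z * z j)
        (f := fun w => t⁻¹ • (w - x)) (by fun_prop))
  have hcs : ∀ j : Fin n, HasCompactSupport (scaledKernel (fun z : Ev n => η z * z j) x t) :=
    fun j => HasCompactSupport.of_support_subset_isCompact (isCompact_closedBall x (R * t))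
      ((subset_tsupport _).trans (tsupport_scaledKernel_subset (hsj j) x ht))
  have key : ∀ w, t⁻¹ * scaledKernel (fun z => n * η z + fderiv ℝ η z z) x t w =
      ∑ j, fderiv ℝ (scaledKernel (fun z : Ev n => η z * z j) x t) w
        (EuclideanSpace.single j 1) := by
    intro w
    have hd : ∀ j : Fin n, fderiv ℝ (scaledKernel (fun z : Ev n => η z * z j) x t) w
        (EuclideanSpace.single j 1) = t⁻¹ ^ n * t⁻¹ * (η (t⁻¹ • (w - x)) +
          (t⁻¹ • (w - x)) j * fderiv ℝ η (t⁻¹ • (w - x)) (EuclideanSpace.single j 1)) := by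
      intro j
      have h1 : HasFDerivAt (fun w : Ev n => t⁻¹ • (w - x))
          (t⁻¹ • ContinuousLinearMap.id ℝ (Ev n)) w :=
        ((hasFDerivAt_id w).sub_const x).const_smul t⁻¹
      have h2 := ((hη.differentiable (by simp)) (t⁻¹ • (w - x))).hasFDerivAt
      have h3 : HasFDerivAt (fun z : Ev n => z j)
          (EuclideanSpace.proj j : Ev n →L[ℝ] ℝ) (t⁻¹ • (w - x)) :=
        (EuclideanSpace.proj j : Ev n →L[ℝ] ℝ).hasFDerivAt
      have h4 := ((h2.mul h3).comp w h1).const_mul (t⁻¹ ^ n)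
      have h5 : fderiv ℝ (scaledKernel (fun z : Ev n => η z * z j) x t) w = _ := h4.fderiv
      rw [h5]
      simp
      ring
    simp_rw [hd]
    rw [← Finset.mul_sum, Finset.sum_add_distrib]
    have hsum : fderiv ℝ η (t⁻¹ • (w - x)) (t⁻¹ • (w - x)) = ∑ j, (t⁻¹ • (w - x)) j *
        fderiv ℝ η (t⁻¹ • (w - x)) (EuclideanSpace.single j 1) := by
      generalize fderiv ℝ η (t⁻¹ • (w - x)) = L
      conv_lhs => rw [← (EuclideanSpace.basisFun (Fin n) ℝ).sum_repr (t⁻¹ • (w - x)), map_sum]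
      simp
    rw [← hsum]
    simp [scaledKernel]
    ring
  simp_rw [key, Finset.mul_sum]
  rw [integral_finsetSum, ← Finset.sum_neg_distrib]
  · exact Finset.sum_congr rfl fun j _ => hG _ (hdK j) (hcs j)
      ((tsupport_scaledKernel_subset (hsj j) x ht).trans hB) j
  · intro j _
    have hcont : Continuous fun w => fderiv ℝ (scaledKernel (fun z : Ev n => η z * z j) x t) w
        (EuclideanSpace.single j 1) :=
      ((hdK j).continuous_fderiv (by simp)).clm_apply continuous_const
    obtain ⟨C, hC⟩ := hcont.bounded_above_of_compact_support
      ((hcs j).fderiv_apply ℝ (EuclideanSpace.single j 1))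
    exact integrableOn_mul_of_bounded hu hcont hC

lemma setAverage_closedBall_mono {f g : Ev n → ℝ} {x : Ev n} {r : ℝ}
    (hf : IntegrableOn f (closedBall x r)) (hg : IntegrableOn g (closedBall x r))
    (h : ∀ w, f w ≤ g w) :
    ⨍ w in closedBall x r, f w ≤ ⨍ w in closedBall x r, g w := by
  rw [setAverage_eq, setAverage_eq, smul_eq_mul, smul_eq_mul]
  exact mul_le_mul_of_nonneg_left (integral_mono hf hg h) (by positivity)

/-- First-order expansion at `x` of the mollification of `u` at scale `t`. -/
lemma abs_integral_mul_scaledKernel_sub_affine_le {Ω : Set (Ev n)} (hΩ : MeasurableSet Ω)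
    {u η : Ev n → ℝ} {G : Ev n → Fin n → ℝ} (hu : IntegrableOn u Ω) (hGi : IntegrableOn G Ω)
    (hG : ∀ η : Ev n → ℝ, ContDiff ℝ (⊤ : ℕ∞) η → HasCompactSupport η → tsupport η ⊆ Ω →
      ∀ j : Fin n, ∫ x in Ω, u x * fderiv ℝ η x (EuclideanSpace.single j 1)
        = - ∫ x in Ω, G x j * η x)
    (hη : ContDiff ℝ (⊤ : ℕ∞) η) (hs : tsupport η ⊆ closedBall 0 2) (hη1 : ∫ z, η z = 1)
    {C : ℝ} (hC : ∀ z, |η z| ≤ C) {c : Ev n} (hc : ∀ j, ∫ z, η z * z j = c j)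
    {x : Ev n} {t : ℝ} (ht : 0 < t) (hB : closedBall x (2 * t) ⊆ Ω) {M : ℝ}
    (hM : ∀ s ∈ Ioc 0 t, ⨍ w in closedBall x (2 * s), ‖G w - G x‖ ≤ M)
    (hL : Tendsto (fun s => ⨍ w in closedBall x (2 * s), |u w - u x|) (𝓝[>] 0) (𝓝 0)) :
    |(∫ w in Ω, u w * scaledKernel η x t w) - u x - t * ∑ j, G x j * c j| ≤
      t * (n * (C * 2 * 2 ^ n * volume.real (closedBall (0 : Ev n) 1)) * M) := by
  set ω := volume.real (closedBall (0 : Ev n) 1) with hω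
  have hω0 : 0 ≤ ω := measureReal_nonneg
  have hC0 : 0 ≤ C := (abs_nonneg _).trans (hC 0)
  have hM0 : 0 ≤ M := by
    refine le_trans ?_ (hM t ⟨ht, le_rfl⟩)
    rw [setAverage_eq, smul_eq_mul]
    exact mul_nonneg (by positivity) (integral_nonneg fun _ => norm_nonneg _)
  set B := n * (C * 2 * 2 ^ n * ω) * M with hBdef
  have hB0 : 0 ≤ B := by positivity
  have hcs : HasCompactSupport η :=
    HasCompactSupport.of_support_subset_isCompact (isCompact_closedBall 0 2)
      ((subset_tsupport _).trans hs)
  set a := ∑ j, G x j * c j with ha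
  set f : ℝ → ℝ := fun s => (∫ w in Ω, u w * scaledKernel η x s w) - s * a with hf
  set f' : ℝ → ℝ := fun s =>
    (∑ j, ∫ w in Ω, G w j * scaledKernel (fun z => η z * z j) x s w) - a with hf'
  have hBs : ∀ s ∈ Ioc 0 t, closedBall x (2 * s) ⊆ Ω := fun s hs =>
    (closedBall_subset_closedBall (by linarith [hs.2])).trans hB
  have hderiv : ∀ s ∈ Ioc 0 t, HasDerivAt f (f' s) s := by
    intro s hs'
    have h1 := hasDerivAt_integral_mul_scaledKernel hu hη hcs x hs'.1
    rw [integral_mul_scaledKernel_radial hu hG hη hs hs'.1 (hBs s hs'), neg_neg] at h1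
    exact h1.sub (by simpa using (hasDerivAt_id s).mul_const a)
  have hGj : ∀ j, IntegrableOn (fun w => G w j) Ω := fun j =>
    (ContinuousLinearMap.proj (R := ℝ) (φ := fun _ : Fin n => ℝ) j).integrable_comp hGi
  have hbound : ∀ s ∈ Ioc 0 t, ‖f' s‖ ≤ B := by
    intro s hs'
    have hfin : volume (closedBall x (2 * s)) ≠ ∞ := measure_closedBall_lt_top.ne
    simp only [hf', ha]
    rw [← Finset.sum_sub_distrib]
    refine (norm_sum_le _ _).trans ?_
    have hj : ∀ j ∈ (Finset.univ : Finset (Fin n)),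
        ‖(∫ w in Ω, G w j * scaledKernel (fun z => η z * z j) x s w) - G x j * c j‖ ≤
          C * 2 * 2 ^ n * ω * M := by
      intro j _
      have hsj : tsupport (fun z : Ev n => η z * z j) ⊆ closedBall 0 2 :=
        (tsupport_mul_subset_left).trans hs
      have hCj : ∀ z : Ev n, |η z * z j| ≤ C * 2 := by
        intro z
        by_cases hz : z ∈ closedBall (0 : Ev n) 2
        · rw [abs_mul]
          have : |z j| ≤ 2 := (PiLp.norm_apply_le z j).trans (mem_closedBall_zero_iff.1 hz)
          exact mul_le_mul (hC z) this (abs_nonneg _) hC0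
        · rw [image_eq_zero_of_notMem_tsupport (f := fun z : Ev n => η z * z j)
            (fun h => hz (hsj h)), abs_zero]
          positivity
      have hcont : Continuous fun z : Ev n => η z * z j :=
        hη.continuous.mul (by fun_prop)
      rw [← hc j, Real.norm_eq_abs]
      refine (abs_integral_mul_scaledKernel_sub_le hΩ (hGj j) hcont two_pos hCj hsj hs'.1
        (hBs s hs')).trans ?_
      refine mul_le_mul_of_nonneg_left (le_trans ?_ (hM s hs')) (by positivity)
      refine setAverage_closedBall_mono
        (((hGj j).mono_set (hBs s hs')).sub (integrableOn_const hfin)).abs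
        ((hGi.mono_set (hBs s hs')).sub (integrableOn_const hfin)).norm fun w => ?_
      exact norm_le_pi_norm (G w - G x) j
    refine (Finset.sum_le_sum hj).trans ?_
    simp [hBdef, mul_assoc]
  have hlim : Tendsto f (𝓝[>] 0) (𝓝 (u x)) := by
    have h1 : Tendsto (fun s => (∫ w in Ω, u w * scaledKernel η x s w) - u x * ∫ z, η z)
        (𝓝[>] 0) (𝓝 0) := by
      refine squeeze_zero_norm' ?_ (by simpa using hL.const_mul (C * 2 ^ n * ω))
      filter_upwards [Ioc_mem_nhdsGT ht] with s hs'
      exact abs_integral_mul_scaledKernel_sub_le hΩ hu hη.continuous two_pos hC hs hs'.1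
        (hBs s hs')
    have h2 : Tendsto (fun s : ℝ => s * a) (𝓝[>] 0) (𝓝 0) :=
      ((continuous_id.mul continuous_const).tendsto' 0 0 (by simp)).mono_left nhdsWithin_le_nhds
    have h3 := (h1.sub h2).add_const (u x)
    rw [hη1] at h3
    simp only [mul_one, sub_zero, zero_add] at h3
    exact h3.congr fun s => by simp only [hf]; ring
  have hle : ∀ δ ∈ Ioc 0 t, ‖f t - f δ‖ ≤ t * B := by
    intro δ hδ
    have := norm_image_sub_le_of_norm_deriv_le_segment' (f := f) (f' := f') (C := B) (a := δ)
      (b := t) (fun s hs' => (hderiv s ⟨hδ.1.trans_le hs'.1, hs'.2⟩).hasDerivWithinAt)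
      (fun s hs' => hbound s ⟨hδ.1.trans_le hs'.1, hs'.2.le⟩) t ⟨hδ.2, le_rfl⟩
    refine this.trans ?_
    rw [mul_comm]
    gcongr
    linarith [hδ.1]
  have hfin : ‖f t - u x‖ ≤ t * B :=
    le_of_tendsto (hlim.const_sub (f t)).norm
      (by filter_upwards [Ioc_mem_nhdsGT ht] with δ hδ using hle δ hδ)
  rw [Real.norm_eq_abs] at hfin
  convert hfin using 2
  simp only [hf]
  ring

/-- The standard mollifier: smooth, even, of unit mass, supported in the unit ball. -/
def mollifier (n : ℕ) : Ev n → ℝ :=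
  (⟨1 / 2, 1, by norm_num, by norm_num⟩ : ContDiffBump (0 : Ev n)).normed volume

lemma contDiff_mollifier : ContDiff ℝ (⊤ : ℕ∞) (mollifier n) :=
  ContDiffBump.contDiff_normed _

lemma tsupport_mollifier : tsupport (mollifier n) = closedBall 0 1 :=
  ContDiffBump.tsupport_normed_eq _

lemma hasCompactSupport_mollifier : HasCompactSupport (mollifier n) :=
  ContDiffBump.hasCompactSupport_normed _

lemma integral_mollifier : ∫ z, mollifier n z = 1 :=
  ContDiffBump.integral_normed _

lemma mollifier_neg (z : Ev n) : mollifier n (-z) = mollifier n z :=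
  ContDiffBump.normed_neg _ z

lemma integral_mollifier_mul_coord (j : Fin n) : ∫ z, mollifier n z * z j = 0 := by
  have h := integral_neg_eq_self (fun z : Ev n => mollifier n z * z j) volume
  simp only [mollifier_neg, PiLp.neg_apply, mul_neg, integral_neg] at h
  linarith

lemma integral_mollifier_sub_mul_coord (c : Ev n) (j : Fin n) :
    ∫ z, mollifier n (z - c) * z j = c j := by
  have h := integral_sub_right_eq_self (μ := (volume : Measure (Ev n)))
    (fun z : Ev n => mollifier n z * (z + c) j) c
  simp only [sub_add_cancel] at h
  rw [h]
  have hm := (contDiff_mollifier (n := n)).continuous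
  have e : ∀ z : Ev n, mollifier n z * (z + c) j = mollifier n z * z j + mollifier n z * c j :=
    fun z => by rw [PiLp.add_apply, mul_add]
  simp_rw [e]
  rw [integral_add, integral_mollifier_mul_coord, integral_mul_const, integral_mollifier,
    one_mul, zero_add]
  · exact (hm.mul (by fun_prop)).integrable_of_hasCompactSupport
      hasCompactSupport_mollifier.mul_right
  · exact (hm.mul continuous_const).integrable_of_hasCompactSupport
      hasCompactSupport_mollifier.mul_right

/-- Quantitative first-order Taylor estimate for a function with integrable weak gradient, in
terms of the mean oscillations of the gradient around the two points. -/
lemma exists_abs_sub_affine_le (n : ℕ) : ∃ K : ℝ, 0 ≤ K ∧ ∀ {Ω : Set (Ev n)}, MeasurableSet Ω →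
    ∀ {u : Ev n → ℝ} {G : Ev n → Fin n → ℝ}, IntegrableOn u Ω → IntegrableOn G Ω →
    (∀ η : Ev n → ℝ, ContDiff ℝ (⊤ : ℕ∞) η → HasCompactSupport η → tsupport η ⊆ Ω →
      ∀ j : Fin n, ∫ x in Ω, u x * fderiv ℝ η x (EuclideanSpace.single j 1)
        = - ∫ x in Ω, G x j * η x) →
    ∀ {x y : Ev n} {M : ℝ}, x ≠ y →
    (∀ z ∈ ({x, y} : Set (Ev n)), closedBall z (2 * ‖y - x‖) ⊆ Ω ∧
      (∀ s ∈ Ioc 0 ‖y - x‖, ⨍ w in closedBall z (2 * s), ‖G w - G z‖ ≤ M) ∧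
      Tendsto (fun s => ⨍ w in closedBall z (2 * s), |u w - u z|) (𝓝[>] 0) (𝓝 0)) →
    |u y - u x - ∑ j, G x j * (y - x) j| ≤ K * M * ‖y - x‖ := by
  obtain ⟨C, hC⟩ := (contDiff_mollifier (n := n)).continuous.bounded_above_of_compact_support
    hasCompactSupport_mollifier
  have hC0 : 0 ≤ C := (norm_nonneg _).trans (hC 0)
  refine ⟨2 * (n * (C * 2 * 2 ^ n * volume.real (closedBall (0 : Ev n) 1))), by positivity, ?_⟩
  intro Ω hΩ u G hu hGi hG x y M hxy H
  have ht : 0 < ‖y - x‖ := norm_pos_iff.2 (sub_ne_zero.2 hxy.symm)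
  set t := ‖y - x‖ with htdef
  have main : ∀ z ∈ ({x, y} : Set (Ev n)), ∀ c : Ev n, ‖c‖ ≤ 1 →
      |(∫ w in Ω, u w * scaledKernel (fun ζ => mollifier n (ζ - c)) z t w) - u z
        - t * ∑ j, G z j * c j| ≤
      t * (n * (C * 2 * 2 ^ n * volume.real (closedBall (0 : Ev n) 1)) * M) := by
    intro z hz c hc
    obtain ⟨h1, h2, h3⟩ := H z hz
    refine abs_integral_mul_scaledKernel_sub_affine_le hΩ hu hGi hG
      (contDiff_mollifier.comp (contDiff_id.sub contDiff_const)) ?_ ?_ (fun ζ => hC _)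
      (integral_mollifier_sub_mul_coord c) ht h1 h2 h3
    · refine closure_minimal (fun ζ hζ => ?_) isClosed_closedBall
      have h4 : ζ - c ∈ closedBall (0 : Ev n) 1 := by
        rw [← tsupport_mollifier]; exact subset_tsupport _ hζ
      rw [mem_closedBall_zero_iff] at h4 ⊢
      calc ‖ζ‖ = ‖(ζ - c) + c‖ := by rw [sub_add_cancel]
        _ ≤ ‖ζ - c‖ + ‖c‖ := norm_add_le _ _
        _ ≤ 2 := by linarith
    · exact (integral_sub_right_eq_self (mollifier n) c).trans integral_mollifier
  have hx := main x (by simp) (t⁻¹ • (y - x))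
    (by rw [norm_smul, norm_inv, norm_norm, ← htdef, inv_mul_cancel₀ ht.ne'])
  have hy := main y (by simp) 0 (by simp)
  have hk : scaledKernel (fun ζ => mollifier n (ζ - t⁻¹ • (y - x))) x t =
      scaledKernel (fun ζ => mollifier n (ζ - 0)) y t := by
    funext w
    simp only [scaledKernel, sub_zero, ← smul_sub, sub_sub_sub_cancel_right]
  have hsum : t * ∑ j, G x j * (t⁻¹ • (y - x)) j = ∑ j, G x j * (y - x) j := by
    rw [Finset.mul_sum]
    refine Finset.sum_congr rfl fun j _ => ?_
    rw [PiLp.smul_apply, smul_eq_mul]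
    field_simp
  rw [hk, hsum] at hx
  simp only [PiLp.zero_apply, mul_zero, Finset.sum_const_zero, sub_zero] at hx hy
  rw [abs_le] at hx hy ⊢
  constructor <;> nlinarith [hx.1, hx.2, hy.1, hy.2]

/-- A function with integrable weak gradient is differentiable along any set on which the gradient
has uniformly small mean oscillation at small scales. -/
lemma hasFDerivWithinAt_of_uniform_oscillation {Ω A : Set (Ev n)} (hΩ : IsOpen Ω) (hA : A ⊆ Ω)
    {u : Ev n → ℝ} {G : Ev n → Fin n → ℝ} (hu : IntegrableOn u Ω) (hGi : IntegrableOn G Ω)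
    (hG : ∀ η : Ev n → ℝ, ContDiff ℝ (⊤ : ℕ∞) η → HasCompactSupport η → tsupport η ⊆ Ω →
      ∀ j : Fin n, ∫ x in Ω, u x * fderiv ℝ η x (EuclideanSpace.single j 1)
        = - ∫ x in Ω, G x j * η x)
    (hosc : ∀ ε > 0, ∃ δ > 0, ∀ x ∈ A, ∀ s ∈ Ioc 0 δ,
      ⨍ w in closedBall x s, ‖G w - G x‖ ≤ ε)
    (hL : ∀ x ∈ A, Tendsto (fun s => ⨍ w in closedBall x (2 * s), |u w - u x|) (𝓝[>] 0) (𝓝 0))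
    {x : Ev n} (hx : x ∈ A) {L : Ev n →L[ℝ] ℝ} (hLx : ∀ v, L v = ∑ j, G x j * v j) :
    HasFDerivWithinAt u L A x := by
  obtain ⟨K, hK0, hK⟩ := exists_abs_sub_affine_le n
  rw [hasFDerivWithinAt_iff_isLittleO, Asymptotics.isLittleO_iff]
  intro ε hε
  obtain ⟨δ, hδ, H⟩ := hosc (ε / (K + 1)) (by positivity)
  obtain ⟨r, hr, hball⟩ := Metric.isOpen_iff.1 hΩ x (hA hx)
  filter_upwards [self_mem_nhdsWithin, mem_nhdsWithin_of_mem_nhds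
    (ball_mem_nhds x (lt_min (half_pos hδ) (by positivity : 0 < r / 4)))] with y hyA hy
  rw [mem_ball, dist_eq_norm, lt_min_iff] at hy
  rcases eq_or_ne x y with rfl | hxy
  · simp
  rw [hLx, Real.norm_eq_abs]
  refine (hK hΩ.measurableSet hu hGi hG hxy (M := ε / (K + 1)) fun z hz => ?_).trans ?_
  · have hzA : z ∈ A ∧ dist z x ≤ ‖y - x‖ := by
      rcases hz with rfl | rfl
      · exact ⟨hx, by simp⟩
      · exact ⟨hyA, (dist_eq_norm _ _).le⟩
    refine ⟨fun w hw => hball ?_, fun s hs => H z hzA.1 (2 * s) ⟨?_, ?_⟩, hL z hzA.1⟩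
    · have := dist_triangle w z x
      rw [mem_closedBall] at hw
      rw [mem_ball]
      linarith [hzA.2, hy.2]
    · linarith [hs.1]
    · linarith [hs.2, hy.1]
  · gcongr
    rw [mul_div_assoc', div_le_iff₀ (by positivity)]
    linarith

/-- Off a set of small measure, the Lebesgue differentiation theorem holds uniformly. -/
lemma exists_uniform_oscillation {F : Type*} [NormedAddCommGroup F] {G : Ev n → F}
    (hGm : StronglyMeasurable G) (hGi : Integrable G) {Ω : Set (Ev n)} (hΩ : MeasurableSet Ω)
    (hΩf : volume Ω ≠ ∞) {θ : ℝ} (hθ : 0 < θ) :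
    ∃ T ⊆ Ω, volume T ≤ ENNReal.ofReal θ ∧ ∀ ε > 0, ∃ δ > 0, ∀ x ∈ Ω \ T, ∀ s ∈ Ioc 0 δ,
      ⨍ w in closedBall x s, ‖G w - G x‖ ≤ ε := by
  set ω := volume.real (closedBall (0 : Ev n) 1) with hω
  have hω0 : 0 < ω := ENNReal.toReal_pos (measure_closedBall_pos _ _ one_pos).ne'
    measure_closedBall_lt_top.ne
  have havg : ∀ (x : Ev n) {r : ℝ}, 0 < r → ⨍ w in closedBall x r, ‖G w - G x‖ =
      (r ^ n * ω)⁻¹ * ∫ w in closedBall x r, ‖G w - G x‖ := fun x r hr => by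
    rw [setIntegral_closedBall_eq _ _ hr, inv_mul_cancel_left₀ (by positivity)]
  set ρ : ℕ → ℝ := fun k => (1 / 2) ^ k with hρ
  have hρ0 : ∀ k, 0 < ρ k := fun k => by positivity
  set f : ℕ → Ev n → ℝ := fun k x => ⨍ w in closedBall x (ρ k), ‖G w - G x‖ with hf
  have hfm : ∀ k, StronglyMeasurable (f k) := by
    intro k
    have h1 : f k = fun x => (ρ k ^ n * ω)⁻¹ *
        ∫ w, {p : Ev n × Ev n | dist p.2 p.1 ≤ ρ k}.indicator
          (fun p => ‖G p.2 - G p.1‖) (x, w) := by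
      funext x
      simp only [hf]
      rw [havg x (hρ0 k), ← integral_indicator measurableSet_closedBall]
      rfl
    rw [h1]
    refine StronglyMeasurable.const_mul (StronglyMeasurable.integral_prod_right'
      (StronglyMeasurable.indicator ?_ ?_)) _
    · exact ((hGm.comp_measurable measurable_snd).sub (hGm.comp_measurable measurable_fst)).norm
    · exact (isClosed_le (by fun_prop) continuous_const).measurableSet
  have hft : ∀ᵐ x ∂(volume : Measure (Ev n)), x ∈ Ω → Tendsto (fun k => f k x) atTop (𝓝 0) := by
    filter_upwards [IsUnifLocDoublingMeasure.ae_tendsto_average_norm_sub volume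
      hGi.locallyIntegrable 1] with x hx _
    refine hx (fun _ => x) ρ (tendsto_nhdsWithin_iff.2
      ⟨tendsto_pow_atTop_nhds_zero_of_lt_one (by norm_num) (by norm_num),
        Eventually.of_forall hρ0⟩) (Eventually.of_forall fun k => ?_)
    exact mem_closedBall_self (by linarith [hρ0 k])
  obtain ⟨T, hT, -, hTm, hTu⟩ := tendstoUniformlyOn_of_ae_tendsto hfm
    (stronglyMeasurable_const (b := (0 : ℝ))) hΩ hΩf hft hθ
  refine ⟨T, hT, hTm, fun ε hε => ?_⟩
  rw [Metric.tendstoUniformlyOn_iff] at hTu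
  obtain ⟨N, hN⟩ := eventually_atTop.1 (hTu (ε / 2 ^ n) (by positivity))
  refine ⟨ρ N, hρ0 N, fun x hx s hs => ?_⟩
  obtain ⟨k, hk1, hk2⟩ := exists_nat_pow_near_of_lt_one hs.1
    (hs.2.trans (pow_le_one₀ (by norm_num) (by norm_num))) (by norm_num : (0 : ℝ) < 1 / 2)
    (by norm_num)
  have hkN : N ≤ k := by
    by_contra! h
    have : (1 / 2 : ℝ) ^ N ≤ (1 / 2) ^ (k + 1) :=
      pow_le_pow_of_le_one (by norm_num) (by norm_num) h
    exact absurd (hk1.trans_le hs.2) this.not_gt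
  have hk := hN k hkN x hx
  have hfk0 : 0 ≤ f k x := by
    simp only [hf]
    rw [havg x (hρ0 k)]
    exact mul_nonneg (by have := hρ0 k; positivity) (integral_nonneg fun _ => norm_nonneg _)
  rw [dist_zero_left, Real.norm_of_nonneg hfk0] at hk
  have hIle : ∫ w in closedBall x s, ‖G w - G x‖ ≤ ∫ w in closedBall x (ρ k), ‖G w - G x‖ :=
    setIntegral_mono_set (hGi.integrableOn.sub
        (integrableOn_const measure_closedBall_lt_top.ne)).norm
      (ae_of_all _ fun _ => norm_nonneg _) (closedBall_subset_closedBall hk2).eventuallyLE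
  have hs0 := hs.1
  have hks : ρ k ≤ 2 * s := by
    rw [pow_succ] at hk1
    simp only [hρ]
    linarith
  have hpow : (ρ k) ^ n ≤ 2 ^ n * s ^ n := by
    rw [← mul_pow]
    exact pow_le_pow_left₀ (hρ0 k).le hks n
  rw [setIntegral_closedBall_eq _ _ hs0, setIntegral_closedBall_eq _ _ (hρ0 k), ← hω,
    mul_right_comm, mul_right_comm (ρ k ^ n)] at hIle
  have h2 := le_of_mul_le_mul_right hIle hω0
  have h3 : s ^ n * ⨍ w in closedBall x s, ‖G w - G x‖ ≤ s ^ n * ε := by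
    calc _ ≤ _ := h2
      _ ≤ (2 ^ n * s ^ n) * (ε / 2 ^ n) := mul_le_mul hpow hk.le hfk0 (by positivity)
      _ = s ^ n * ε := by field_simp
  exact le_of_mul_le_mul_left h3 (by positivity)

/-- A mapping of class `W¹_1` is differentiable along a subset of `Ω` of almost full measure, the
derivative being the weak one. -/
lemma exists_hasFDerivWithinAt_of_weakDeriv {Ω : Set (Ev n)} (hΩ : IsOpen Ω)
    (hΩf : volume Ω ≠ ∞) {φ : Ev n → Ev n} {G : Ev n → Fin n → Fin n → ℝ}
    (hφ : IntegrableOn φ Ω) (hGm : StronglyMeasurable G) (hGi : Integrable G)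
    (hG : ∀ η : Ev n → ℝ, ContDiff ℝ (⊤ : ℕ∞) η → HasCompactSupport η → tsupport η ⊆ Ω →
      ∀ i j : Fin n, ∫ x in Ω, φ x i * fderiv ℝ η x (EuclideanSpace.single j 1)
        = - ∫ x in Ω, G x i j * η x) {θ : ℝ} (hθ : 0 < θ) :
    ∃ A ⊆ Ω, volume (Ω \ A) ≤ ENNReal.ofReal θ ∧ ∀ x ∈ A, HasFDerivWithinAt φ
      (Matrix.toEuclideanLin (Matrix.of (G x))).toContinuousLinearMap A x := by
  obtain ⟨T, hTΩ, hT, hosc⟩ := exists_uniform_oscillation hGm hGi hΩ.measurableSet hΩf hθ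
  have hLeb : ∀ᵐ x ∂(volume : Measure (Ev n)), x ∈ Ω → ∀ i : Fin n,
      Tendsto (fun s => ⨍ w in closedBall x (2 * s), |φ w i - φ x i|) (𝓝[>] 0) (𝓝 0) := by
    have h1 := fun i : Fin n => IsUnifLocDoublingMeasure.ae_tendsto_average_norm_sub volume
      (f := Ω.indicator fun x => φ x i) ((integrable_indicator_iff hΩ.measurableSet).2
        ((EuclideanSpace.proj (𝕜 := ℝ) i).integrable_comp hφ)).locallyIntegrable 1
    rw [← ae_all_iff] at h1
    filter_upwards [h1] with x hx hxΩ i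
    have h0 : Tendsto (fun s : ℝ => 2 * s) (𝓝[>] 0) (𝓝[>] 0) := by
      refine tendsto_nhdsWithin_iff.2 ⟨?_, ?_⟩
      · exact ((continuous_const.mul continuous_id).tendsto' 0 0 (by simp)).mono_left
          nhdsWithin_le_nhds
      · filter_upwards [self_mem_nhdsWithin] with s hs
        simpa using hs
    refine (hx i (fun _ => x) (fun s : ℝ => 2 * s) h0 ?_).congr' ?_
    · filter_upwards [self_mem_nhdsWithin] with s hs
      exact mem_closedBall_self (by linarith [mem_Ioi.1 hs])
    · obtain ⟨r, hr, hball⟩ := Metric.isOpen_iff.1 hΩ x hxΩ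
      filter_upwards [Ioo_mem_nhdsGT (half_pos hr)] with s hs
      rw [setAverage_eq, setAverage_eq]
      congr 1
      refine setIntegral_congr_fun measurableSet_closedBall fun w hw => ?_
      have hw' : w ∈ Ω := hball (closedBall_subset_ball (by linarith [hs.2]) hw)
      simp only [indicator_of_mem hw', indicator_of_mem hxΩ, Real.norm_eq_abs]
  set N := {x | ¬ (x ∈ Ω → ∀ i : Fin n,
      Tendsto (fun s => ⨍ w in closedBall x (2 * s), |φ w i - φ x i|) (𝓝[>] 0) (𝓝 0))} with hN
  have hN0 : volume N = 0 := hLeb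
  refine ⟨(Ω \ T) \ N, sdiff_subset.trans sdiff_subset, ?_, fun x hx => ?_⟩
  · calc volume (Ω \ ((Ω \ T) \ N)) ≤ volume (T ∪ N) := measure_mono fun x hx => by
          by_contra h
          rw [mem_union, not_or] at h
          exact hx.2 ⟨⟨hx.1, h.1⟩, h.2⟩
      _ ≤ volume T + volume N := measure_union_le _ _
      _ ≤ _ := by rwa [hN0, add_zero]
  · rw [hasFDerivWithinAt_euclidean]
    intro i
    have hGp : IntegrableOn (fun w => G w i) Ω :=
      (ContinuousLinearMap.proj (R := ℝ) (φ := fun _ : Fin n => Fin n → ℝ) i).integrable_comp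
        hGi.integrableOn
    refine hasFDerivWithinAt_of_uniform_oscillation (G := fun w => G w i) hΩ
      (sdiff_subset.trans sdiff_subset) ((EuclideanSpace.proj (𝕜 := ℝ) i).integrable_comp hφ)
      hGp (fun η h1 h2 h3 => hG η h1 h2 h3 i) (fun ε hε => ?_) (fun z hz => ?_) hx (fun v => ?_)
    · obtain ⟨δ, hδ, H⟩ := hosc ε hε
      refine ⟨δ, hδ, fun z hz s hs => le_trans ?_ (H z hz.1 s hs)⟩
      exact setAverage_closedBall_mono
        ((((ContinuousLinearMap.proj (R := ℝ) (φ := fun _ : Fin n => Fin n → ℝ) i).integrable_comp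
          hGi).integrableOn.sub (integrableOn_const measure_closedBall_lt_top.ne)).norm)
        (hGi.integrableOn.sub (integrableOn_const measure_closedBall_lt_top.ne)).norm
        fun w => norm_le_pi_norm (G w - G z) i
    · have h := hz.2
      simp only [hN, mem_ofPred_eq, not_not] at h
      exact h hz.1.1 i
    · simp [Matrix.mulVec, dotProduct]

/-- Lemma 2.9.  An almost everywhere injective mapping
`φ : Ω → Ω'` of class `W¹_1(Ω)` with `J(x,φ) ≥ 0` a.e. and the Luzin
`𝒩⁻¹`-property satisfies `J(x,φ) > 0` a.e. in `Ω`. -/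
theorem statement10 (n : ℕ) (hn : 1 ≤ n)
    (Ω Ω' : Set (Ev n))
    (hΩ : IsBoundedDomain Ω) (hΩ' : IsBoundedDomain Ω')
    (φ : Ev n → Ev n) (Dφ : Ev n → Mat n)
    (hmaps : MapsTo φ Ω Ω')
    (hsob : MemW1 1 Ω φ Dφ)
    (hinj : AEInjectiveOn φ Ω)
    (hJ : ∀ᵐ x ∂(volume.restrict Ω), 0 ≤ (Dφ x).det)
    (hLuzin : ∀ A : Set (Ev n), A ⊆ Ω' → volume A = 0 → volume (Ω ∩ φ ⁻¹' A) = 0) :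
    ∀ᵐ x ∂(volume.restrict Ω), 0 < (Dφ x).det := by
  obtain ⟨hΩo, -, hΩb⟩ := hΩ
  obtain ⟨hφ, ⟨hloc, hweak⟩, hfin⟩ := hsob
  have hΩf : volume Ω ≠ ∞ := hΩb.measure_lt_top.ne
  have hDij : ∀ i j, IntegrableOn (fun x => Dφ x i j) Ω := by
    intro i j
    refine ⟨(hloc i j).aestronglyMeasurable, lt_of_le_of_lt (lintegral_mono fun x => ?_) hfin⟩
    rw [← ofReal_norm, Real.rpow_one, Real.norm_eq_abs]
    refine ENNReal.ofReal_le_ofReal (Real.abs_le_sqrt ?_)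
    calc (Dφ x i j) ^ 2 ≤ ∑ j, (Dφ x i j) ^ 2 :=
          Finset.single_le_sum (f := fun j => (Dφ x i j) ^ 2) (fun _ _ => sq_nonneg _)
            (Finset.mem_univ j)
      _ ≤ ∑ i, ∑ j, (Dφ x i j) ^ 2 :=
          Finset.single_le_sum (f := fun i => ∑ j, (Dφ x i j) ^ 2)
            (fun _ _ => Finset.sum_nonneg fun _ _ => sq_nonneg _) (Finset.mem_univ i)
  have hD : Integrable (Ω.indicator fun x (i j : Fin n) => Dφ x i j) := by
    rw [integrable_indicator_iff hΩo.measurableSet]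
    exact Integrable.of_eval fun i => Integrable.of_eval fun j => hDij i j
  set G : Ev n → Fin n → Fin n → ℝ := hD.aestronglyMeasurable.mk _ with hGdef
  have hGD : ∀ᵐ x ∂(volume.restrict Ω), (fun i j => Dφ x i j) = G x := by
    filter_upwards [ae_restrict_of_ae hD.aestronglyMeasurable.ae_eq_mk,
      ae_restrict_mem hΩo.measurableSet] with x hx hxΩ
    rw [hGdef, ← hx, indicator_of_mem hxΩ]
  have hG : ∀ η : Ev n → ℝ, ContDiff ℝ (⊤ : ℕ∞) η → HasCompactSupport η → tsupport η ⊆ Ω →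
      ∀ i j : Fin n, ∫ x in Ω, φ x i * fderiv ℝ η x (EuclideanSpace.single j 1)
        = - ∫ x in Ω, G x i j * η x := by
    intro η h1 h2 h3 i j
    rw [hweak η h1 h2 h3 i j]
    congr 1
    refine integral_congr_ae ?_
    filter_upwards [hGD] with x hx
    rw [← hx]
  have hzero : volume {x ∈ Ω | (Matrix.of (G x)).det = 0} = 0 := by
    refine le_antisymm (ENNReal.le_of_forall_pos_le_add fun θ hθ _ => ?_) zero_le
    obtain ⟨A, hA, hAm, hAd⟩ := exists_hasFDerivWithinAt_of_weakDeriv hΩo hΩf hφ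
      hD.aestronglyMeasurable.stronglyMeasurable_mk
      (hD.congr hD.aestronglyMeasurable.ae_eq_mk) hG (NNReal.coe_pos.2 hθ)
    set Z := {x ∈ A | (Matrix.of (G x)).det = 0} with hZ
    have himage : volume (φ '' Z) = 0 :=
      addHaar_image_eq_zero_of_det_fderivWithin_eq_zero volume
        (fun x hx => (hAd x hx.1).mono (sep_subset _ _))
        (fun x hx => by
          rw [ContinuousLinearMap.det, LinearMap.coe_toContinuousLinearMap,
            LinearMap.det_toLpLin]
          exact hx.2)
    have hpre := hLuzin (φ '' Z) (image_subset_iff.2 fun x hx => hmaps (hA hx.1)) himage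
    calc volume {x ∈ Ω | (Matrix.of (G x)).det = 0}
        ≤ volume ((Ω ∩ φ ⁻¹' (φ '' Z)) ∪ (Ω \ A)) := measure_mono fun x hx => by
          by_cases hxA : x ∈ A
          · exact Or.inl ⟨hx.1, mem_image_of_mem φ ⟨hxA, hx.2⟩⟩
          · exact Or.inr ⟨hx.1, hxA⟩
      _ ≤ volume (Ω ∩ φ ⁻¹' (φ '' Z)) + volume (Ω \ A) := measure_union_le _ _
      _ ≤ 0 + θ := by
          rw [hpre]
          gcongr
          rwa [ENNReal.ofReal_coe_nnreal] at hAm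
  have hne : ∀ᵐ x ∂(volume.restrict Ω), (Matrix.of (G x)).det ≠ 0 := by
    rw [ae_restrict_iff' hΩo.measurableSet, ae_iff]
    simpa using hzero
  filter_upwards [hJ, hne, hGD] with x h1 h2 h3
  refine lt_of_le_of_ne h1 fun h => h2 ?_
  rw [← h3]
  exact h.symm

end Paper
end
end

section
/- Let φ : Ω → Ω′ be a quasi-isometric mapping between open sets in ℝⁿ. Then for any fixed ball B compactly contained in Ω there is a constant L, depending only on the choice of B, such that d_{φ(B)}(φ(x), φ(y)) ≤ L |φ(x) − φ(y)| for all points x, y ∈ B, where d_{φ(B)} denotes the intrinsic metric of the open set φ(B). -/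
open MeasureTheory Set Filter Topology Metric Matrix
open scoped ENNReal NNReal

noncomputable section

namespace Paper

/-- The intrinsic (interior) metric of a set `E ⊂ ℝⁿ`: the infimum of lengths of
rectifiable curves in `E` joining `u` to `v`. -/
def intrinsicDist {n : ℕ} (E : Set (Ev n)) (u v : Ev n) : ℝ :=
  sInf {L : ℝ | 0 ≤ L ∧ ∃ γ : ℝ → Ev n, ContinuousOn γ (Set.Icc 0 1) ∧
    γ 0 = u ∧ γ 1 = v ∧ (∀ t ∈ Set.Icc (0 : ℝ) 1, γ t ∈ E) ∧
    eVariationOn γ (Set.Icc 0 1) = ENNReal.ofReal L}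

/-- `φ : U → U'` is a quasi-isometric homeomorphism with constant `M` and inverse `ψ`:
`limsup_{y→x} |φ(y)−φ(x)|/|y−x| ≤ M` for all `x ∈ U` and symmetrically for `ψ`. -/
def QuasiIsometric {n : ℕ} (U U' : Set (Ev n)) (φ ψ : Ev n → Ev n) (M : ℝ) : Prop :=
  IsHomeoOn φ ψ U U' ∧
  (∀ x ∈ U, ∀ ε : ℝ, 0 < ε → ∃ δ : ℝ, 0 < δ ∧ ∀ y ∈ U, dist y x < δ →
    dist (φ y) (φ x) ≤ (M + ε) * dist y x) ∧
  (∀ z ∈ U', ∀ ε : ℝ, 0 < ε → ∃ δ : ℝ, 0 < δ ∧ ∀ w ∈ U', dist w z < δ →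
    dist (ψ w) (ψ z) ≤ (M + ε) * dist w z)

/-- On a convex set, a pointwise bound on the local Lipschitz constant is a global one. -/
theorem lipschitzOnWith_of_pointwise {E F : Type*} [NormedAddCommGroup E] [NormedSpace ℝ E]
    [PseudoMetricSpace F] {f : E → F} {s : Set E} {K : ℝ≥0} (hs : Convex ℝ s)
    (hf : ∀ x ∈ s, ∃ δ : ℝ, 0 < δ ∧ ∀ y ∈ s, dist y x < δ → dist (f y) (f x) ≤ K * dist y x) :
    LipschitzOnWith K f s := by
  refine LipschitzOnWith.of_dist_le_mul fun y hy x hx => ?_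
  have hmem : ∀ t ∈ Icc (0 : ℝ) 1, AffineMap.lineMap x y t ∈ s := fun t ht =>
    hs.lineMap_mem hx hy ht
  have hcont : ContinuousOn f s := by
    intro u hu
    obtain ⟨δ, hδ, h⟩ := hf u hu
    refine tendsto_iff_dist_tendsto_zero.2 (squeeze_zero' (g := fun v => K * dist v u) ?_ ?_ ?_)
    · exact Eventually.of_forall fun _ => dist_nonneg
    · filter_upwards [self_mem_nhdsWithin, mem_nhdsWithin_of_mem_nhds (ball_mem_nhds u hδ)]
        with v hv hvδ using h v hv hvδ
    · have hc : Continuous fun v => (K : ℝ) * dist v u := by fun_prop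
      simpa using (hc.tendsto u).mono_left nhdsWithin_le_nhds
  have key := image_le_of_liminf_slope_right_le_deriv_boundary (a := 0) (b := 1)
    (f := fun t : ℝ => dist (f (AffineMap.lineMap x y t)) (f x))
    (B := fun t => K * dist y x * t) (B' := fun _ => K * dist y x)
    ((continuous_id.dist continuous_const).comp_continuousOn
      (hcont.comp AffineMap.lineMap_continuous.continuousOn hmem))
    (by simp) (by fun_prop)
    (fun t _ => by simpa using ((hasDerivAt_id t).const_mul (K * dist y x)).hasDerivWithinAt)
    (fun t ht r hr => ?_) (right_mem_Icc.2 zero_le_one)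
  · simpa using key
  · obtain ⟨δ, hδ, h⟩ := hf _ (hmem t (Ico_subset_Icc_self ht))
    have hnear : ∀ᶠ w in 𝓝[>] t,
        dist (AffineMap.lineMap x y w : E) (AffineMap.lineMap x y t) < δ :=
      ((AffineMap.lineMap_continuous.tendsto t).eventually
        (ball_mem_nhds (AffineMap.lineMap x y t : E) hδ)).filter_mono nhdsWithin_le_nhds
    refine Eventually.frequently ?_
    filter_upwards [hnear, Ioo_mem_nhdsGT ht.2] with w hwδ hw
    have hwt : 0 < w - t := sub_pos.2 hw.1
    have hle := h _ (hmem w ⟨ht.1.trans hw.1.le, hw.2.le⟩) hwδ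
    rw [dist_lineMap_lineMap, Real.dist_eq, abs_of_pos hwt, dist_comm x y] at hle
    refine lt_of_le_of_lt ?_ hr
    rw [slope_def_field, div_le_iff₀ hwt]
    have htri := dist_triangle (f (AffineMap.lineMap x y w)) (f (AffineMap.lineMap x y t)) (f x)
    linarith

/-- On an open set, a pointwise bound on the local Lipschitz constant makes a map locally
Lipschitz. -/
theorem locallyLipschitzOn_of_pointwise {E F : Type*} [NormedAddCommGroup E] [NormedSpace ℝ E]
    [PseudoMetricSpace F] {f : E → F} {s : Set E} {K : ℝ≥0} (hs : IsOpen s)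
    (hf : ∀ x ∈ s, ∃ δ : ℝ, 0 < δ ∧ ∀ y ∈ s, dist y x < δ → dist (f y) (f x) ≤ K * dist y x) :
    LocallyLipschitzOn s f := by
  intro x hx
  obtain ⟨r, hr, hrs⟩ := Metric.isOpen_iff.1 hs x hx
  refine ⟨K, ball x r, mem_nhdsWithin_of_mem_nhds (ball_mem_nhds x hr),
    lipschitzOnWith_of_pointwise (convex_ball x r) fun u hu => ?_⟩
  obtain ⟨δ, hδ, h⟩ := hf u (hrs hu)
  exact ⟨δ, hδ, fun v hv => h v (hrs hv)⟩

/-- The intrinsic metric of the image of a convex set under a Lipschitz map is controlled by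
the Euclidean distance of the preimages. -/
theorem intrinsicDist_image_le {n : ℕ} {f : Ev n → Ev n} {s : Set (Ev n)} {K : ℝ≥0}
    (hs : Convex ℝ s) (hf : LipschitzOnWith K f s) {x y : Ev n} (hx : x ∈ s) (hy : y ∈ s) :
    intrinsicDist (f '' s) (f x) (f y) ≤ K * dist x y := by
  have hmem : MapsTo (AffineMap.lineMap x y : ℝ → Ev n) (Icc 0 1) s := fun t ht =>
    hs.lineMap_mem hx hy ht
  have hlip : LipschitzOnWith (K * nndist x y) (f ∘ (AffineMap.lineMap x y : ℝ → Ev n))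
      (Icc 0 1) :=
    hf.comp (lipschitzWith_lineMap x y).lipschitzOnWith hmem
  have hvar : eVariationOn (f ∘ (AffineMap.lineMap x y : ℝ → Ev n)) (Icc 0 1) ≤
      ENNReal.ofReal (K * dist x y) := by
    have h := hlip.comp_eVariationOn_le (g := id) (mapsTo_id (Icc (0 : ℝ) 1))
    have hid := (monotone_id.monotoneOn (Icc (0 : ℝ) 1)).eVariationOn_eq
      (left_mem_Icc.2 zero_le_one) (right_mem_Icc.2 zero_le_one)
    rw [inter_self] at hid
    refine h.trans ((mul_le_mul_right hid.le _).trans_eq ?_)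
    rw [dist_nndist, ← NNReal.coe_mul, ENNReal.ofReal_coe_nnreal]
    simp
  have hfin := ne_top_of_le_ne_top ENNReal.ofReal_ne_top hvar
  refine le_trans ?_ (ENNReal.toReal_le_of_le_ofReal (by positivity) hvar)
  exact csInf_le ⟨0, fun L hL => hL.1⟩ ⟨ENNReal.toReal_nonneg,
    f ∘ (AffineMap.lineMap x y : ℝ → Ev n), hlip.continuousOn, by simp, by simp,
    fun t ht => mem_image_of_mem f (hmem ht), (ENNReal.ofReal_toReal hfin).symm⟩

/-- Lemma A.1.  Let `φ : Ω → Ω'` be a quasi-isometric mapping of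
open sets in `ℝⁿ`.  Then for any ball `B ⋐ Ω` there is a constant `L`, depending only
on the choice of `B`, such that `d_{φ(B)}(φ(x), φ(y)) ≤ L·|φ(x) − φ(y)|` for all
`x, y ∈ B`, `d_{φ(B)}` being the intrinsic metric of `φ(B)`. -/
theorem statement15 (n : ℕ) (hn : 1 ≤ n)
    (U U' : Set (Ev n)) (hU : IsOpen U) (hU' : IsOpen U')
    (φ ψ : Ev n → Ev n) (M : ℝ)
    (hqi : QuasiIsometric U U' φ ψ M)
    (z : Ev n) (R : ℝ) (hR : 0 < R)
    (hB : closure (Metric.ball z R) ⊆ U) :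
    ∃ L : ℝ, ∀ x ∈ Metric.ball z R, ∀ y ∈ Metric.ball z R,
      intrinsicDist (φ '' Metric.ball z R) (φ x) (φ y) ≤ L * dist (φ x) (φ y) := by
  obtain ⟨hhomeo, hφ, hψ⟩ := hqi
  have hcb : closedBall z R ⊆ U := by rwa [closure_ball z hR.ne'] at hB
  have hM : M + 1 ≤ ((|M| + 1).toNNReal : ℝ) := by
    rw [Real.coe_toNNReal _ (by positivity)]
    linarith [le_abs_self M]
  have hφlip : LipschitzOnWith (|M| + 1).toNNReal φ (ball z R) := by
    have hsub := ball_subset_closedBall.trans hcb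
    refine lipschitzOnWith_of_pointwise (convex_ball z R) fun x hx => ?_
    obtain ⟨δ, hδ, h⟩ := hφ x (hsub hx) 1 one_pos
    exact ⟨δ, hδ, fun y hy hyx =>
      (h y (hsub hy) hyx).trans (mul_le_mul_of_nonneg_right hM dist_nonneg)⟩
  have hψloc : LocallyLipschitzOn U' ψ := by
    refine locallyLipschitzOn_of_pointwise (K := (|M| + 1).toNNReal) hU' fun w hw => ?_
    obtain ⟨δ, hδ, h⟩ := hψ w hw 1 one_pos
    exact ⟨δ, hδ, fun v hv hvw =>
      (h v hv hvw).trans (mul_le_mul_of_nonneg_right hM dist_nonneg)⟩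
  obtain ⟨K, hK⟩ := (hψloc.mono
    ((hhomeo.mapsTo.mono_left hcb).image_subset)).exists_lipschitzOnWith_of_compact
      ((isCompact_closedBall z R).image_of_continuousOn (hhomeo.cont.mono hcb))
  refine ⟨(|M| + 1).toNNReal * K, fun x hx y hy => ?_⟩
  have hx' := ball_subset_closedBall hx
  have hy' := ball_subset_closedBall hy
  have hxy := hK.dist_le_mul _ (mem_image_of_mem φ hx') _ (mem_image_of_mem φ hy')
  rw [hhomeo.left_inv x (hcb hx'), hhomeo.left_inv y (hcb hy')] at hxy
  rw [mul_assoc]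
  exact (intrinsicDist_image_le (convex_ball z R) hφlip hx hy).trans
    (mul_le_mul_of_nonneg_left hxy NNReal.zero_le_coe)

end Paper
end
end
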